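/- Let χ be a primitive Dirichlet character (mod n). Then Σ_{k=1}^{n} gcd(k − 1, n) χ(k) = φ(n). -/

import Mathlib

open Finset

theorem ZMod.sum_Icc_natCast {M : Type*} [AddCommMonoid M] (n : ℕ) [NeZero n] (f : ZMod n → M) :
    ∑ k ∈ Icc 1 n, f k = ∑ a, f a := by
  have hrange : ∑ k ∈ range n, f (k + 1) = ∑ a, f (a + 1) :=
    Finset.sum_bij' (fun k _ ↦ (k : ZMod n)) (fun a _ ↦ a.val) (by simp)
      (fun a _ ↦ mem_range.2 a.val_lt)
      (fun k hk ↦ ZMod.val_cast_of_lt (mem_range.1 hk)) (by simp) (by simp)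
  have hshift := Finset.sum_Ico_add' (fun k : ℕ ↦ f k) 0 n 1
  rw [zero_add, Ico_add_one_right_eq_Icc] at hshift
  rw [← hshift, ← range_eq_Ico, ← Equiv.sum_comp (Equiv.addRight 1) f]
  simpa using hrange

theorem Int.natCast_gcd_eq_sum_totient (n : ℕ) (hn : n ≠ 0) (m : ℤ) :
    Int.gcd m n = ∑ d ∈ n.divisors, if (m : ZMod d) = 0 then d.totient else 0 := by
  rw [← Finset.sum_filter, ← Nat.sum_totient (Int.gcd m n)]
  refine Finset.sum_congr ?_ fun _ _ ↦ rfl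
  ext d
  simp [Int.dvd_gcd_iff, ZMod.intCast_zmod_eq_zero_iff_dvd, hn, and_comm,
    Int.natCast_dvd_natCast]

/-- The sum of a character over the residues congruent to `1` modulo a divisor `d` of its level
through which it does not factor is zero. -/
theorem DirichletCharacter.sum_cast_eq_one_eq_zero {R : Type*} [CommRing R] [IsDomain R] {n : ℕ}
    [NeZero n] {χ : DirichletCharacter R n} {d : ℕ} (hd : d ∣ n) (h : ¬ χ.FactorsThrough d) :
    ∑ a : ZMod n with (a.cast : ZMod d) = 1, χ a = 0 := by
  rw [factorsThrough_iff_ker_unitsMap hd, SetLike.not_le_iff_exists] at h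
  obtain ⟨u, hu, hχ⟩ := h
  have hu1 : ((u : ZMod n).cast : ZMod d) = 1 := by
    simpa [MonoidHom.mem_ker, Units.ext_iff, ZMod.unitsMap_val] using hu
  have hχu : χ u ≠ 1 := by
    simpa [MonoidHom.mem_ker, Units.ext_iff] using hχ
  refine eq_zero_of_mul_eq_self_left hχu ?_
  rw [Finset.sum_filter, Finset.mul_sum]
  refine Fintype.sum_equiv u.mulLeft _ _ fun a ↦ ?_
  simp [ZMod.cast_mul hd, hu1]

/-- Let `χ` be a primitive Dirichlet character (mod `n`).  Then
`∑_{k=1}^{n} gcd (k - 1) n · χ(k) = φ n`. -/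
theorem menon_primitive_character_gcd (n : ℕ) (hn : 0 < n)
    (χ : DirichletCharacter ℂ n) (hprim : χ.IsPrimitive) :
    ∑ k ∈ Finset.Icc 1 n, (Int.gcd ((k : ℤ) - 1) (n : ℤ) : ℂ) * χ (k : ZMod n)
      = (Nat.totient n : ℂ) := by
  have : NeZero n := ⟨hn.ne'⟩
  calc
    _ = ∑ k ∈ Icc 1 n, ∑ d ∈ n.divisors,
          (d.totient : ℂ) * if ((k : ZMod n).cast : ZMod d) = 1 then χ (k : ZMod n) else 0 := by
      refine Finset.sum_congr rfl fun k _ ↦ ?_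
      rw [Int.natCast_gcd_eq_sum_totient n hn.ne', Nat.cast_sum, Finset.sum_mul]
      refine Finset.sum_congr rfl fun d hd ↦ ?_
      rw [ZMod.cast_natCast (Nat.dvd_of_mem_divisors hd)]
      simp [sub_eq_zero]
    _ = ∑ d ∈ n.divisors, (d.totient : ℂ) * ∑ a : ZMod n with (a.cast : ZMod d) = 1, χ a := by
      rw [Finset.sum_comm]
      refine Finset.sum_congr rfl fun d _ ↦ ?_
      rw [← Finset.mul_sum, Finset.sum_filter,
        ZMod.sum_Icc_natCast n fun a ↦ if (a.cast : ZMod d) = 1 then χ a else 0]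
    _ = n.totient := by
      rw [Finset.sum_eq_single_of_mem n (Nat.mem_divisors_self n hn.ne')]
      · simp [Finset.sum_filter]
      · intro d hd hdn
        have hdvd := Nat.dvd_of_mem_divisors hd
        rw [DirichletCharacter.sum_cast_eq_one_eq_zero hdvd, mul_zero]
        intro h
        have hdvd' := χ.conductor_dvd_of_mem_conductorSet h
        rw [hprim] at hdvd'
        exact hdn (Nat.dvd_antisymm hdvd hdvd')
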